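/- arXiv:2105.08303 — 2 statements merged into one kernel-verified Lean document; each statement's English description precedes it below -/
import Mathlib

section
/- Let K ∈ ℝ and N ∈ (0,∞), and let (P_t) be a tracially symmetric quantum Markov semigroup on M_n(ℂ) with Lindblad form satisfying the gradient estimate GE(K,N) for the logarithmic mean. Then for every invertible density matrix ρ, the entropy power F(t) := U_N(P_tρ)² = exp(−2·Ent(P_tρ)/N) satisfies F''(t) ≤ −2K·F'(t) for all t ≥ 0. In particular, if K ≥ 0, then the entropy power t ↦ U_N(P_tρ)² is concave on [0,∞). -/
open Matrix Filter
open scoped ComplexOrder ENNReal Kronecker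

namespace CD

abbrev Mat (ι : Type*) := Matrix ι ι ℂ

variable {ι : Type*}

noncomputable def trn [Fintype ι] (x : Mat ι) : ℂ :=
  (Fintype.card ι : ℂ)⁻¹ * x.trace

noncomputable def inn [Fintype ι] (x y : Mat ι) : ℂ := trn (xᴴ * y)

def matLE [Fintype ι] (A B : Mat ι) : Prop := (B - A).PosSemidef

def blockify [Fintype ι] {m : ℕ} (B : Fin m → Fin m → Mat ι) :
    Matrix (Fin m × ι) (Fin m × ι) ℂ :=
  Matrix.of fun p q => B p.1 q.1 p.2 q.2

def IsCP [Fintype ι] (Φ : Mat ι →ₗ[ℂ] Mat ι) : Prop :=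
  ∀ (m : ℕ) (B : Fin m → Fin m → Mat ι),
    (blockify B).PosSemidef → (blockify fun j k => Φ (B j k)).PosSemidef

structure QMS (ι : Type*) [Fintype ι] [DecidableEq ι] where
  P : ℝ → Mat ι →ₗ[ℂ] Mat ι
  gen : Mat ι →ₗ[ℂ] Mat ι
  P_zero : P 0 = LinearMap.id
  P_add : ∀ s t : ℝ, P (s + t) = (P s) ∘ₗ (P t)
  P_cp : ∀ t : ℝ, 0 ≤ t → IsCP (P t)
  P_unital : ∀ t : ℝ, 0 ≤ t → P t 1 = 1
  P_cont : ∀ (x : Mat ι) (i j : ι), Continuous fun t : ℝ => P t x i j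
  P_deriv : ∀ (x : Mat ι) (i j : ι),
    HasDerivAt (fun t : ℝ => P t x i j) (-(gen x i j)) 0

variable [Fintype ι] [DecidableEq ι]

def TraciallySymm (Q : QMS ι) : Prop :=
  ∀ t : ℝ, 0 ≤ t → ∀ x y : Mat ι, trn (Q.P t x * y) = trn (x * Q.P t y)

noncomputable def Gamma (L : Mat ι →ₗ[ℂ] Mat ι) (a b : Mat ι) : Mat ι :=
  (2:ℂ)⁻¹ • (aᴴ * L b + (L a)ᴴ * b - L (aᴴ * b))

noncomputable def Gamma2 (L : Mat ι →ₗ[ℂ] Mat ι) (a b : Mat ι) : Mat ι :=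
  (2:ℂ)⁻¹ • (Gamma L a (L b) + Gamma L (L a) b - L (Gamma L a b))

noncomputable def BE (L : Mat ι →ₗ[ℂ] Mat ι) (K ν : ℝ) : Prop :=
  ∀ a : Mat ι, matLE (K • Gamma L a a + ν • ((L a)ᴴ * (L a))) (Gamma2 L a a)

noncomputable def cK (K t : ℝ) : ℝ :=
  if K = 0 then 2 * t else (1 - Real.exp (-(2 * K * t))) / K

noncomputable def comm (v x : Mat ι) : Mat ι := v * x - x * v

def LindbladForm (L : Mat ι →ₗ[ℂ] Mat ι) {d : ℕ} (v : Fin d → Mat ι) : Prop :=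
  (∀ j, ∃ k, (v j)ᴴ = v k) ∧ ∀ x, L x = ∑ j, comm ((v j)ᴴ) (comm (v j) x)

def Intertwining (Q : QMS ι) {d : ℕ} (v : Fin d → Mat ι) (K : ℝ) : Prop :=
  ∀ t : ℝ, 0 ≤ t → ∀ (j : Fin d) (x : Mat ι),
    comm (v j) (Q.P t x) = Real.exp (-(K * t)) • Q.P t (comm (v j) x)

def CBE (L : Mat ι →ₗ[ℂ] Mat ι) (K ν : ℝ) : Prop :=
  ∀ (m : ℕ) (x : Fin m → Mat ι),
    (blockify (fun j k => Gamma2 L (x j) (x k)) -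
      (K • blockify (fun j k => Gamma L (x j) (x k)) +
       ν • blockify (fun j k => (L (x j))ᴴ * (L (x k))))).PosSemidef

def IsDensity (ρ : Mat ι) : Prop := ρ.PosSemidef ∧ trn ρ = 1

def IsInvDensity (ρ : Mat ι) : Prop := ρ.PosDef ∧ trn ρ = 1

def sliceL {κ : Type*} (x : Mat (ι × κ)) (a b : κ) : Mat ι :=
  Matrix.of fun i j => x (i, a) (j, b)

def sliceR {κ : Type*} (x : Mat (κ × ι)) (a b : κ) : Mat ι :=
  Matrix.of fun i j => x (a, i) (b, j)

noncomputable def lTensor (Φ : Mat ι →ₗ[ℂ] Mat ι) (κ : Type*) :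
    Mat (ι × κ) →ₗ[ℂ] Mat (ι × κ) where
  toFun x := Matrix.of fun p q => Φ (sliceL x p.2 q.2) p.1 q.1
  map_add' x y := by
    ext p q
    have h : sliceL (x + y) p.2 q.2 = sliceL x p.2 q.2 + sliceL y p.2 q.2 := rfl
    simp only [Matrix.of_apply, h, map_add, Matrix.add_apply]
  map_smul' c x := by
    ext p q
    have h : sliceL (c • x) p.2 q.2 = c • sliceL x p.2 q.2 := rfl
    simp only [Matrix.of_apply, h, _root_.map_smul, Matrix.smul_apply, RingHom.id_apply]

noncomputable def rTensor (Ψ : Mat ι →ₗ[ℂ] Mat ι) (κ : Type*) :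
    Mat (κ × ι) →ₗ[ℂ] Mat (κ × ι) where
  toFun x := Matrix.of fun p q => Ψ (sliceR x p.1 q.1) p.2 q.2
  map_add' x y := by
    ext p q
    have h : sliceR (x + y) p.1 q.1 = sliceR x p.1 q.1 + sliceR y p.1 q.1 := rfl
    simp only [Matrix.of_apply, h, map_add, Matrix.add_apply]
  map_smul' c x := by
    ext p q
    have h : sliceR (c • x) p.1 q.1 = c • sliceR x p.1 q.1 := rfl
    simp only [Matrix.of_apply, h, _root_.map_smul, Matrix.smul_apply, RingHom.id_apply]

end CD

namespace CD

variable {ι : Type*} [Fintype ι] [DecidableEq ι]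

/-- Real power `ρ^s` of a (positive) matrix via continuous functional calculus. -/
noncomputable def mpow (ρ : Mat ι) (s : ℝ) : Mat ι := cfc (fun x : ℝ => x ^ s) ρ

/-- Matrix logarithm via continuous functional calculus. -/
noncomputable def mlog (ρ : Mat ι) : Mat ι := cfc Real.log ρ

/-- The logarithmic mean `ρ̂(x) = ∫₀¹ ρ^s x ρ^{1−s} ds` (entrywise integral). -/
noncomputable def logMean (ρ x : Mat ι) : Mat ι :=
  Matrix.of fun i j => ∫ s in (0:ℝ)..1, (mpow ρ s * x * mpow ρ (1 - s)) i j

/-- `‖∂a‖²_ρ = ∑ⱼ ⟨ρ̂(∂ⱼa), ∂ⱼa⟩` for the logarithmic mean. -/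
noncomputable def dNormSqLog {J : Type*} [Fintype J] (v : J → Mat ι)
    (ρ a : Mat ι) : ℝ :=
  ∑ j, (inn (logMean ρ (comm (v j) a)) (comm (v j) a)).re

/-- The gradient estimate `GE(K,N)` for the logarithmic mean (`ν = 1/N`). -/
noncomputable def GElog {J : Type*} [Fintype J] (P : ℝ → Mat ι →ₗ[ℂ] Mat ι)
    (L : Mat ι →ₗ[ℂ] Mat ι) (v : J → Mat ι) (K ν : ℝ) : Prop :=
  ∀ t : ℝ, 0 ≤ t → ∀ a ρ : Mat ι, ρ.PosDef → trn ρ = 1 →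
    dNormSqLog v ρ (P t a) ≤
      Real.exp (-(2 * K * t)) * dNormSqLog v (P t ρ) a -
        ν * cK K t * Complex.normSq (inn a (L (P t ρ)))

/-- The (relative) entropy `Ent(ρ) = τ(ρ log ρ)`. -/
noncomputable def Ent (ρ : Mat ι) : ℝ := (trn (ρ * mlog ρ)).re

end CD


namespace CD

section FunctionalCalculus

variable {ι : Type*} [Fintype ι] [DecidableEq ι]

lemma cfc_eq_conj_diagonal {A : Mat ι} (hA : A.IsHermitian) (f : ℝ → ℝ) :
    cfc f A = (hA.eigenvectorUnitary : Mat ι) * diagonal (fun i => (f (hA.eigenvalues i) : ℂ)) *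
      (hA.eigenvectorUnitary : Mat ι)ᴴ := by
  rw [hA.cfc_eq, IsHermitian.cfc, Unitary.conjStarAlgAut_apply]
  rfl

lemma continuousOn_spectrum (A : Mat ι) (f : ℝ → ℝ) : ContinuousOn f (spectrum ℝ A) :=
  A.finite_real_spectrum.continuousOn f

lemma pos_of_mem_spectrum {A : Mat ι} (hA : A.PosDef) {x : ℝ} (hx : x ∈ spectrum ℝ A) : 0 < x := by
  obtain ⟨i, rfl⟩ := hA.isHermitian.spectrum_real_eq_range_eigenvalues ▸ hx
  exact hA.eigenvalues_pos i

/-- The trace of a product of functions of two Hermitian matrices, in terms of the overlaps of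
their eigenbases. -/
lemma trace_cfc_mul_cfc {A B : Mat ι} (hA : A.IsHermitian) (hB : B.IsHermitian) (f g : ℝ → ℝ) :
    (cfc f A * cfc g B).trace.re = ∑ i, ∑ j, f (hA.eigenvalues i) * g (hB.eigenvalues j) *
      Complex.normSq (((hA.eigenvectorUnitary : Mat ι)ᴴ * (hB.eigenvectorUnitary : Mat ι)) i j) := by
  rw [cfc_eq_conj_diagonal hA, cfc_eq_conj_diagonal hB]
  set U : Mat ι := hA.eigenvectorUnitary.1
  set V : Mat ι := hB.eigenvectorUnitary.1
  set D := diagonal (fun i => (f (hA.eigenvalues i) : ℂ))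
  set E := diagonal (fun i => (g (hB.eigenvalues i) : ℂ))
  have h : (U * D * Uᴴ * (V * E * Vᴴ)).trace = (D * (Uᴴ * V) * E * (Uᴴ * V)ᴴ).trace := by
    rw [show U * D * Uᴴ * (V * E * Vᴴ) = U * (D * (Uᴴ * V) * E * Vᴴ) by simp only [mul_assoc],
      Matrix.trace_mul_comm]
    simp only [mul_assoc, conjTranspose_mul, conjTranspose_conjTranspose]
  rw [h]
  simp only [trace, diag_apply, mul_apply (M := D * (Uᴴ * V) * E), D, E, mul_diagonal,
    diagonal_mul, conjTranspose_apply, Complex.re_sum]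
  refine Finset.sum_congr rfl fun i _ => Finset.sum_congr rfl fun j _ => ?_
  generalize (Uᴴ * V) i j = z
  simp [Complex.normSq_apply]
  ring

/-- Klein's inequality for the relative entropy of positive definite matrices. -/
lemma klein_inequality {A B : Mat ι} (hA : A.PosDef) (hB : B.PosDef) :
    A.trace.re - B.trace.re ≤ (A * mlog A).trace.re - (A * mlog B).trace.re := by
  have hA' := hA.isHermitian
  have hB' := hB.isHermitian
  have hAid : cfc (fun x : ℝ => x) A = A := cfc_id' ℝ A hA'
  have hBid : cfc (fun x : ℝ => x) B = B := cfc_id' ℝ B hB'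
  have hA1 : cfc (fun _ : ℝ => (1 : ℝ)) A = 1 := cfc_const_one ℝ A hA'
  have hB1 : cfc (fun _ : ℝ => (1 : ℝ)) B = 1 := cfc_const_one ℝ B hB'
  have e1 : A.trace.re = (cfc (fun x : ℝ => x) A * cfc (fun _ : ℝ => (1 : ℝ)) B).trace.re := by
    rw [hAid, hB1, mul_one]
  have e2 : B.trace.re = (cfc (fun _ : ℝ => (1 : ℝ)) A * cfc (fun x : ℝ => x) B).trace.re := by
    rw [hBid, hA1, one_mul]
  have e3 : (A * mlog A).trace.re =
      (cfc (fun x : ℝ => x * Real.log x) A * cfc (fun _ : ℝ => (1 : ℝ)) B).trace.re := by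
    rw [cfc_mul _ _ A (continuousOn_spectrum A _) (continuousOn_spectrum A _), hAid, hB1, mul_one]
    rfl
  have e4 : (A * mlog B).trace.re =
      (cfc (fun x : ℝ => x) A * cfc Real.log B).trace.re := by
    rw [hAid]; rfl
  rw [e1, e2, e3, e4]
  simp only [trace_cfc_mul_cfc hA' hB', ← Finset.sum_sub_distrib]
  refine Finset.sum_le_sum fun i _ => Finset.sum_le_sum fun j _ => ?_
  rw [← sub_mul, ← sub_mul]
  refine mul_le_mul_of_nonneg_right ?_ (Complex.normSq_nonneg _)
  have hp : 0 < hA'.eigenvalues i := hA.eigenvalues_pos i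
  have hq : 0 < hB'.eigenvalues j := hB.eigenvalues_pos j
  set p := hA'.eigenvalues i
  set q := hB'.eigenvalues j
  have := Real.log_le_sub_one_of_pos (div_pos hq hp)
  rw [Real.log_div hq.ne' hp.ne'] at this
  have h2 := mul_le_mul_of_nonneg_left this hp.le
  have h3 : p * (q / p - 1) = q - p := by field_simp
  linarith

lemma one_sub_smul_eq_cfc {A : Mat ι} (hA : A.IsHermitian) (c : ℝ) :
    1 - c⁻¹ • A = cfc (fun x : ℝ => 1 - c⁻¹ * x) A := by
  rw [cfc_sub _ _ A (continuousOn_spectrum A _) (continuousOn_spectrum A _),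
    cfc_const_mul _ _ A (continuousOn_spectrum A _), cfc_id' ℝ A hA.isSelfAdjoint,
    cfc_const_one ℝ A hA.isSelfAdjoint]

lemma hasSum_log_series {A : Mat ι} (hA : A.IsHermitian) {c : ℝ} (hc : 0 < c)
    (h : ∀ x ∈ spectrum ℝ A, |1 - c⁻¹ * x| < 1) :
    HasSum (fun k : ℕ => ((k : ℝ)⁻¹) • (1 - c⁻¹ • A) ^ k)
      (Real.log c • (1 : Mat ι) - mlog A) := by
  have hy := one_sub_smul_eq_cfc hA c
  have hk : ∀ k : ℕ, ((k : ℝ)⁻¹) • (1 - c⁻¹ • A) ^ k =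
      cfc (fun x : ℝ => (k : ℝ)⁻¹ * (1 - c⁻¹ * x) ^ k) A := by
    intro k
    rw [hy, cfc_const_mul _ _ A (continuousOn_spectrum A _),
      cfc_pow _ k A (continuousOn_spectrum A _) hA.isSelfAdjoint]
  have hl : Real.log c • (1 : Mat ι) - mlog A = cfc (fun x : ℝ => Real.log c - Real.log x) A := by
    rw [cfc_sub _ _ A (continuousOn_spectrum A _) (continuousOn_spectrum A _),
      cfc_const _ A hA.isSelfAdjoint, Algebra.algebraMap_eq_smul_one]
    rfl
  simp only [hk, hl, cfc_eq_conj_diagonal hA]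
  refine HasSum.mul_right _ (HasSum.mul_left _ ?_)
  refine HasSum.matrix_diagonal (Pi.hasSum.2 fun i => ?_)
  refine Complex.hasSum_ofReal.2 ?_
  have hi := h _ (hA.eigenvalues_mem_spectrum_real i)
  set x := hA.eigenvalues i
  have hx : 0 < x := by
    by_contra hx
    have : c⁻¹ * x ≤ 0 := mul_nonpos_of_nonneg_of_nonpos (by positivity) (not_lt.1 hx)
    linarith [(abs_lt.1 hi).2]
  have hs := Real.hasSum_pow_div_log_of_abs_lt_one hi
  have e : -Real.log (1 - (1 - c⁻¹ * x)) = Real.log c - Real.log x := by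
    rw [sub_sub_cancel, Real.log_mul (by positivity) hx.ne', Real.log_inv]; ring
  rw [e] at hs
  refine (hasSum_nat_add_iff' 1).1 ?_
  simpa [div_eq_inv_mul] using hs

end FunctionalCalculus

section LogDifferentiability

open scoped Matrix.Norms.L2Operator Topology

variable {ι : Type*} [Fintype ι] [DecidableEq ι]

lemma norm_le_of_mem_spectrum {A : Mat ι} {x : ℝ} (hx : x ∈ spectrum ℝ A) : ‖x‖ ≤ ‖A‖ := by
  cases isEmpty_or_nonempty ι
  · simp [spectrum.of_subsingleton] at hx
  · have : NormOneClass (Mat ι) := CStarRing.instNormOneClassOfNontrivial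
    exact spectrum.norm_le_norm_of_mem hx

/-- Near a positive definite matrix, Hermitian matrices are positive definite, and on them the
matrix logarithm agrees with a differentiable function. -/
lemma exists_differentiable_mlog {A : Mat ι} (hA : A.PosDef) :
    ∃ G : Mat ι → Mat ι, DifferentiableAt ℝ G A ∧
      ∀ᶠ B in 𝓝 A, B.IsHermitian → B.PosDef ∧ mlog B = G B := by
  classical
  set c : ℝ := ‖A‖ + 1 with hcdef
  have hc : 0 < c := by positivity
  set p : FormalMultilinearSeries ℝ (Mat ι) (Mat ι) :=
    FormalMultilinearSeries.ofScalars (Mat ι) (fun k : ℕ => (k : ℝ)⁻¹) with hp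
  have hr : 1 ≤ p.radius := by
    have := FormalMultilinearSeries.inv_le_ofScalars_radius_of_tendsto (E := Mat ι)
      (c := fun k : ℕ => (k : ℝ)⁻¹) (r := 1) one_ne_zero ?_
    · simpa using this
    · refine (tendsto_natCast_div_add_atTop (1 : ℝ)).congr fun k => ?_
      have : |(k : ℝ) + 1| = k + 1 := abs_of_nonneg (by positivity)
      simp [div_eq_mul_inv, mul_comm, this]
  have hps := p.hasFPowerSeriesOnBall (lt_of_lt_of_le one_pos hr)
  set Y : Mat ι → Mat ι := fun B => 1 - c⁻¹ • B with hY
  have hYd : Differentiable ℝ Y := by fun_prop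
  have hYA : ‖Y A‖ < 1 := by
    have hYc : Y A = _ := (one_sub_smul_eq_cfc hA.isHermitian c).trans
      (cfc_eq_conj_diagonal hA.isHermitian _)
    rw [hYc, ← star_eq_conjTranspose, ← Unitary.coe_star, CStarRing.norm_mul_coe_unitary,
      CStarRing.norm_coe_unitary_mul, l2_opNorm_diagonal, pi_norm_lt_iff one_pos]
    intro i
    have hx := hA.isHermitian.eigenvalues_mem_spectrum_real i
    have h0 := pos_of_mem_spectrum hA hx
    have h1 := norm_le_of_mem_spectrum hx
    set x := hA.isHermitian.eigenvalues i
    rw [Complex.norm_real, Real.norm_eq_abs, abs_lt]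
    rw [Real.norm_eq_abs, abs_of_pos h0] at h1
    have h2 : 0 < c⁻¹ * x := by positivity
    have h3 : c⁻¹ * x < 1 := by
      rw [inv_mul_lt_one₀ hc]; linarith
    constructor <;> linarith
  have hmem : ∀ B, ‖Y B‖ < 1 → Y B ∈ Metric.eball (0 : Mat ι) p.radius := by
    intro B hB
    refine Metric.eball_subset_eball hr ?_
    rw [mem_eball_zero_iff]
    rw [← ofReal_norm, ← ENNReal.ofReal_one]
    exact (ENNReal.ofReal_lt_ofReal_iff one_pos).2 hB
  refine ⟨fun B => Real.log c • (1 : Mat ι) - p.sum (Y B), ?_, ?_⟩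
  · have h1 : DifferentiableAt ℝ p.sum (Y A) := by
      have := hps.analyticAt_of_mem (hmem A hYA)
      exact this.differentiableAt
    exact (differentiableAt_const _).sub (h1.comp A (hYd A))
  · have hev : ∀ᶠ B in 𝓝 A, ‖Y B‖ < 1 :=
      (hYd.continuous.norm.continuousAt (x := A)).eventually_lt continuousAt_const hYA
    filter_upwards [hev] with B hB hBh
    have hsp : ∀ x ∈ spectrum ℝ B, |1 - c⁻¹ * x| < 1 := by
      intro x hx
      refine lt_of_le_of_lt (norm_le_of_mem_spectrum (A := Y B) ?_) hB
      rw [show Y B = _ from one_sub_smul_eq_cfc hBh c,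
        cfc_map_spectrum _ B hBh.isSelfAdjoint (continuousOn_spectrum B _)]
      exact ⟨x, hx, rfl⟩
    refine ⟨?_, ?_⟩
    · refine hBh.posDef_iff_eigenvalues_pos.2 fun i => ?_
      have hi := hsp _ (hBh.eigenvalues_mem_spectrum_real i)
      by_contra hx
      have : c⁻¹ * hBh.eigenvalues i ≤ 0 :=
        mul_nonpos_of_nonneg_of_nonpos (by positivity) (not_lt.1 hx)
      linarith [(abs_lt.1 hi).2]
    · have h1 := hasSum_log_series hBh hc hsp
      have h2 := p.hasSum (hmem B hB)
      simp only [hp, FormalMultilinearSeries.ofScalars_apply_eq] at h2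
      have := h1.unique h2
      rw [← this]; simp

end LogDifferentiability

end CD

namespace CD

section LogarithmicMean

variable {ι : Type*} [Fintype ι] [DecidableEq ι]

lemma isHermitian_cfc (f : ℝ → ℝ) (A : Mat ι) : (cfc f A).IsHermitian :=
  cfc_predicate f A

lemma isHermitian_mpow (A : Mat ι) (s : ℝ) : (mpow A s).IsHermitian := isHermitian_cfc _ A

lemma isHermitian_mlog (A : Mat ι) : (mlog A).IsHermitian := isHermitian_cfc _ A

lemma mpow_add {A : Mat ι} (hA : A.PosDef) (s t : ℝ) : mpow A (s + t) = mpow A s * mpow A t := by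
  rw [mpow, mpow, mpow, ← cfc_mul _ _ A (continuousOn_spectrum A _) (continuousOn_spectrum A _)]
  exact cfc_congr fun x hx => Real.rpow_add (pos_of_mem_spectrum hA hx) s t

lemma mpow_zero {A : Mat ι} (hA : A.PosDef) : mpow A 0 = 1 := by
  simp only [mpow, Real.rpow_zero]
  exact cfc_const_one ℝ A hA.isHermitian.isSelfAdjoint

lemma mpow_one {A : Mat ι} (hA : A.PosDef) : mpow A 1 = A := by
  simp only [mpow, Real.rpow_one]
  exact cfc_id' ℝ A hA.isHermitian.isSelfAdjoint

lemma hasDerivAt_mpow_apply {A : Mat ι} (hA : A.PosDef) (i j : ι) (s : ℝ) :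
    HasDerivAt (fun s => mpow A s i j) ((mpow A s * mlog A) i j) s := by
  have h1 : ∀ s, mpow A s i j = ∑ k, (hA.isHermitian.eigenvectorUnitary : Mat ι) i k *
      ((hA.isHermitian.eigenvalues k ^ s : ℝ) : ℂ) *
        (hA.isHermitian.eigenvectorUnitary : Mat ι)ᴴ k j := by
    intro s
    rw [mpow, cfc_eq_conj_diagonal hA.isHermitian, mul_apply]
    simp only [mul_diagonal]
  have h2 : mpow A s * mlog A = cfc (fun x : ℝ => x ^ s * Real.log x) A :=
    (cfc_mul _ _ A (continuousOn_spectrum A _) (continuousOn_spectrum A _)).symm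
  rw [h2, cfc_eq_conj_diagonal hA.isHermitian, mul_apply]
  simp only [h1, mul_diagonal]
  refine HasDerivAt.fun_sum fun k _ => ?_
  refine HasDerivAt.mul_const (HasDerivAt.const_mul _ ?_) _
  have hp : 0 < hA.isHermitian.eigenvalues k := hA.eigenvalues_pos k
  exact (Real.hasStrictDerivAt_const_rpow hp s).hasDerivAt.ofReal_comp

lemma continuous_mpow {A : Mat ι} (hA : A.PosDef) : Continuous (mpow A) :=
  continuous_matrix fun i j => continuous_iff_continuousAt.2 fun s =>
    (hasDerivAt_mpow_apply hA i j s).continuousAt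

lemma continuous_mpow_mul_mul {A : Mat ι} (hA : A.PosDef) (x : Mat ι) :
    Continuous fun s : ℝ => mpow A s * x * mpow A (1 - s) := by
  have := continuous_mpow hA
  fun_prop

lemma mpow_mul_mlog_comm (A : Mat ι) (s : ℝ) : mpow A s * mlog A = mlog A * mpow A s :=
  (cfc_commute_cfc _ _ A).eq

omit [DecidableEq ι] in
lemma HasDerivAt.matrix_mul_apply {X Y : ℝ → Mat ι} {X' Y' : Mat ι} {s : ℝ}
    (hX : ∀ i j, HasDerivAt (fun s => X s i j) (X' i j) s)
    (hY : ∀ i j, HasDerivAt (fun s => Y s i j) (Y' i j) s) (i j : ι) :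
    HasDerivAt (fun s => (X s * Y s) i j) ((X' * Y s + X s * Y') i j) s := by
  simp only [mul_apply, Matrix.add_apply, ← Finset.sum_add_distrib]
  exact HasDerivAt.fun_sum fun k _ => (hX i k).mul (hY k j)

/-- The chain rule `ρ̂(∂ log ρ) = ∂ρ` for the logarithmic mean. -/
lemma logMean_comm_mlog {A : Mat ι} (hA : A.PosDef) (v : Mat ι) :
    logMean A (comm v (mlog A)) = comm v A := by
  ext i j
  have hd : ∀ s, HasDerivAt (fun s => (mpow A s * (-v) * mpow A (1 - s)) i j)
      ((mpow A s * comm v (mlog A) * mpow A (1 - s)) i j) s := by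
    intro s
    have h1 : ∀ i j, HasDerivAt (fun s => (mpow A s * (-v)) i j)
        ((mpow A s * mlog A * (-v)) i j) s := by
      intro i j
      have := HasDerivAt.matrix_mul_apply (Y := fun _ => -v) (Y' := 0)
        (fun i j => hasDerivAt_mpow_apply hA i j s) (fun i j => hasDerivAt_const s _) i j
      simpa using this
    have h2 : ∀ i j, HasDerivAt (fun s => mpow A (1 - s) i j)
        ((-(mpow A (1 - s) * mlog A)) i j) s := by
      intro i j
      have := (hasDerivAt_mpow_apply hA i j (1 - s)).scomp s ((hasDerivAt_id s).const_sub 1)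
      simpa [Function.comp_def] using this
    have h3 : mpow A s * comm v (mlog A) * mpow A (1 - s) =
        mpow A s * mlog A * -v * mpow A (1 - s) +
          mpow A s * -v * -(mpow A (1 - s) * mlog A) := by
      rw [comm, mpow_mul_mlog_comm A (1 - s)]
      noncomm_ring
    rw [h3]
    exact HasDerivAt.matrix_mul_apply h1 h2 i j
  have hc : Continuous fun s => (mpow A s * comm v (mlog A) * mpow A (1 - s)) i j :=
    (continuous_mpow_mul_mul hA _).matrix_elem i j
  rw [logMean, of_apply, intervalIntegral.integral_eq_sub_of_hasDerivAt (fun s _ => hd s)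
    (hc.intervalIntegrable _ _)]
  simp only [sub_self, sub_zero, mpow_zero hA, mpow_one hA, comm, Matrix.sub_apply]
  simp [sub_eq_add_neg, add_comm]

omit [DecidableEq ι] in
lemma inn_eq_sum (x y : Mat ι) :
    inn x y = (Fintype.card ι : ℂ)⁻¹ * ∑ i, ∑ j, star (x j i) * y j i := by
  simp only [inn, trn, trace, diag_apply, mul_apply, conjTranspose_apply]

omit [DecidableEq ι] in
lemma inn_integral {X : ℝ → Mat ι} (hX : Continuous X) (y : Mat ι) :
    inn (Matrix.of fun i j => ∫ s in (0 : ℝ)..1, X s i j) y =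
      ∫ s in (0 : ℝ)..1, inn (X s) y := by
  have hc : ∀ i j, Continuous fun s : ℝ => star (X s j i) * y j i := fun i j =>
    ((hX.matrix_elem j i).star).mul continuous_const
  have hi : ∀ (f : ℝ → ℂ), ∫ s in (0 : ℝ)..1, star (f s) = star (∫ s in (0 : ℝ)..1, f s) := by
    intro f
    simp only [intervalIntegral.integral_of_le zero_le_one]
    exact integral_conj
  simp only [inn_eq_sum, of_apply]
  rw [intervalIntegral.integral_const_mul, intervalIntegral.integral_finsetSum]
  · congr 1
    refine Finset.sum_congr rfl fun i _ => ?_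
    rw [intervalIntegral.integral_finsetSum fun j _ => (hc i j).intervalIntegrable _ _]
    refine Finset.sum_congr rfl fun j _ => ?_
    rw [intervalIntegral.integral_mul_const, hi]
  · exact fun i _ => (continuous_finsetSum _ fun j _ => hc i j).intervalIntegrable _ _

/-- The real bilinear form `(x, y) ↦ Re ⟨ρ̂(x), y⟩` as an integral. -/
lemma re_inn_logMean {A : Mat ι} (hA : A.PosDef) (x y : Mat ι) :
    (inn (logMean A x) y).re =
      ∫ s in (0 : ℝ)..1, (inn (mpow A s * x * mpow A (1 - s)) y).re := by
  have hc := continuous_mpow_mul_mul hA x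
  have hcont : Continuous fun s => inn (mpow A s * x * mpow A (1 - s)) y := by
    unfold inn trn
    exact continuous_const.mul (hc.matrix_conjTranspose.matrix_mul continuous_const).matrix_trace
  rw [logMean, inn_integral hc]
  exact (intervalIntegral.intervalIntegral_re (𝕜 := ℂ) (hcont.intervalIntegrable _ _)).symm

lemma inn_mpow_comm (A x y : Mat ι) (s : ℝ) :
    (inn (mpow A s * x * mpow A (1 - s)) y).re = (inn (mpow A s * y * mpow A (1 - s)) x).re := by
  have h : inn (mpow A s * y * mpow A (1 - s)) x =
      star (inn (mpow A s * x * mpow A (1 - s)) y) := by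
    simp only [inn, trn, star_mul', ← trace_conjTranspose, conjTranspose_mul,
      conjTranspose_conjTranspose, (isHermitian_mpow A _).eq]
    congr 1
    · simp
    · simp only [mul_assoc]
      rw [trace_mul_comm]
      simp only [mul_assoc]
  rw [h]; simp

omit [DecidableEq ι] in
lemma inn_self_re_nonneg (x : Mat ι) : 0 ≤ (inn x x).re := by
  have h : 0 ≤ inn x x := by
    refine mul_nonneg (by positivity) (posSemidef_conjTranspose_mul_self x).trace_nonneg
  exact (Complex.le_def.1 h).1

lemma inn_mpow_self_nonneg {A : Mat ι} (hA : A.PosDef) (x : Mat ι) (s : ℝ) :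
    0 ≤ (inn (mpow A s * x * mpow A (1 - s)) x).re := by
  have h : inn (mpow A s * x * mpow A (1 - s)) x =
      inn (mpow A (s / 2) * x * mpow A ((1 - s) / 2)) (mpow A (s / 2) * x * mpow A ((1 - s) / 2)) := by
    have h1 : mpow A s = mpow A (s / 2) * mpow A (s / 2) := by rw [← mpow_add hA, add_halves]
    have h2 : mpow A (1 - s) = mpow A ((1 - s) / 2) * mpow A ((1 - s) / 2) := by
      rw [← mpow_add hA, add_halves]
    simp only [inn, trn, conjTranspose_mul, (isHermitian_mpow A _).eq]
    rw [h1, h2, mul_assoc, mul_assoc, trace_mul_comm]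
    simp only [mul_assoc]
  rw [h]; exact inn_self_re_nonneg _

omit [DecidableEq ι] in
lemma inn_add_right (x y z : Mat ι) : inn x (y + z) = inn x y + inn x z := by
  simp [inn, trn, mul_add]

omit [DecidableEq ι] in
lemma inn_smul_right (x y : Mat ι) (c : ℝ) : inn x (c • y) = c * inn x y := by
  simp [inn, trn]; ring

lemma re_inn_logMean_comm {A : Mat ι} (hA : A.PosDef) (x y : Mat ι) :
    (inn (logMean A x) y).re = (inn (logMean A y) x).re := by
  simp only [re_inn_logMean hA, inn_mpow_comm A x y]

lemma re_inn_logMean_self_nonneg {A : Mat ι} (hA : A.PosDef) (x : Mat ι) :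
    0 ≤ (inn (logMean A x) x).re := by
  rw [re_inn_logMean hA]
  exact intervalIntegral.integral_nonneg zero_le_one fun s _ => inn_mpow_self_nonneg hA x s

lemma re_inn_logMean_add_smul_self {A : Mat ι} (hA : A.PosDef) (x y : Mat ι) (c : ℝ) :
    (inn (logMean A (x + c • y)) (x + c • y)).re = (inn (logMean A y) y).re * (c * c) +
      2 * (inn (logMean A x) y).re * c + (inn (logMean A x) x).re := by
  have h : ∀ z, (inn (logMean A z) (x + c • y)).re =
      (inn (logMean A x) z).re + c * (inn (logMean A y) z).re := by
    intro z
    rw [inn_add_right, inn_smul_right, Complex.add_re, Complex.re_ofReal_mul,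
      re_inn_logMean_comm hA z x, re_inn_logMean_comm hA z y]
  rw [h, re_inn_logMean_comm hA x (x + _), re_inn_logMean_comm hA y (x + _)]
  rw [re_inn_logMean_comm hA (x + _) x, re_inn_logMean_comm hA (x + _) y, h, h,
    re_inn_logMean_comm hA y x]
  ring

lemma sq_sum_re_inn_logMean_le {J : Type*} [Fintype J] {A : Mat ι} (hA : A.PosDef)
    (x y : J → Mat ι) :
    (∑ j, (inn (logMean A (x j)) (y j)).re) ^ 2 ≤
      (∑ j, (inn (logMean A (y j)) (y j)).re) * ∑ j, (inn (logMean A (x j)) (x j)).re := by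
  have h := discrim_le_zero (a := ∑ j, (inn (logMean A (y j)) (y j)).re)
    (b := 2 * ∑ j, (inn (logMean A (x j)) (y j)).re)
    (c := ∑ j, (inn (logMean A (x j)) (x j)).re) fun t => by
      have : 0 ≤ ∑ j, (inn (logMean A (x j + t • y j)) (x j + t • y j)).re :=
        Finset.sum_nonneg fun j _ => re_inn_logMean_self_nonneg hA _
      simp only [re_inn_logMean_add_smul_self hA, Finset.sum_add_distrib, ← Finset.sum_mul,
        ← Finset.mul_sum] at this
      exact this
  rw [discrim] at h
  linarith

end LogarithmicMean

end CD

namespace CD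

section EntropyDerivative

open scoped Matrix.Norms.L2Operator Topology

variable {ι : Type*} [Fintype ι] [DecidableEq ι]

/-- The real part of the normalized trace, as a continuous real-linear functional. -/
noncomputable def reTrn : Mat ι →L[ℝ] ℝ :=
  LinearMap.toContinuousLinearMap
    { toFun := fun x => (trn x).re
      map_add' := fun x y => by simp [trn, mul_add]
      map_smul' := fun c x => by simp [trn, trace_smul]; ring }

omit [DecidableEq ι] in
lemma reTrn_apply (x : Mat ι) : reTrn x = (trn x).re := rfl

omit [DecidableEq ι] in
lemma reTrn_eq (x : Mat ι) : reTrn x = (Fintype.card ι : ℝ)⁻¹ * x.trace.re := by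
  rw [reTrn_apply, trn, ← Complex.ofReal_natCast, ← Complex.ofReal_inv, Complex.re_ofReal_mul]

omit [DecidableEq ι] in
lemma reTrn_mul_comm (x y : Mat ι) : reTrn (x * y) = reTrn (y * x) := by
  rw [reTrn_eq, reTrn_eq, trace_mul_comm]

lemma reTrn_klein {A B : Mat ι} (hA : A.PosDef) (hB : B.PosDef) :
    reTrn A - reTrn B ≤ reTrn (A * mlog A) - reTrn (A * mlog B) := by
  simp only [reTrn_eq, ← mul_sub]
  exact mul_le_mul_of_nonneg_left (klein_inequality hA hB) (by positivity)

variable {R : ℝ → Mat ι} {R' : Mat ι} {t : ℝ}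

lemma eventually_posDef (hR : ContinuousAt R t) (hpos : (R t).PosDef)
    (hherm : ∀ s, (R s).IsHermitian) : ∀ᶠ s in 𝓝 t, (R s).PosDef := by
  obtain ⟨G, -, hG⟩ := exists_differentiable_mlog hpos
  filter_upwards [hR.eventually hG] with s hs using (hs (hherm s)).1

lemma differentiableAt_mlog_comp (hR : DifferentiableAt ℝ R t) (hpos : (R t).PosDef)
    (hherm : ∀ s, (R s).IsHermitian) : DifferentiableAt ℝ (fun s => mlog (R s)) t := by
  obtain ⟨G, hGd, hG⟩ := exists_differentiable_mlog hpos
  have h : (fun s => mlog (R s)) =ᶠ[𝓝 t] fun s => G (R s) := by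
    filter_upwards [hR.continuousAt.eventually hG] with s hs using (hs (hherm s)).2
  exact (hGd.comp t hR).congr_of_eventuallyEq h

/-- The derivative of the entropy along a differentiable curve of positive definite matrices. -/
lemma hasDerivAt_Ent (hR : HasDerivAt R R' t) (hpos : (R t).PosDef)
    (hherm : ∀ s, (R s).IsHermitian) :
    HasDerivAt (fun s => Ent (R s)) (reTrn ((mlog (R t) + 1) * R')) t := by
  set A : ℝ → Mat ι := fun s => mlog (R s) with hA
  have hAd := (differentiableAt_mlog_comp hR.differentiableAt hpos hherm).hasDerivAt
  have hE : HasDerivAt (fun s => reTrn ((A s - A t) * (R s - R t))) 0 t := by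
    have := reTrn.hasFDerivAt.comp_hasDerivAt t ((hAd.sub_const (A t)).mul (hR.sub_const (R t)))
    rw [sub_self, sub_self, mul_zero, zero_mul, zero_add, map_zero] at this
    exact this
  have hL : HasDerivAt (fun s => reTrn ((A t + 1) * (R s - R t))) (reTrn ((A t + 1) * R')) t :=
    reTrn.hasFDerivAt.comp_hasDerivAt t ((hR.sub_const (R t)).const_mul (A t + 1))
  have hEnt : ∀ s, Ent (R s) = reTrn (R s * A s) := fun s => rfl
  have hD : HasDerivAt
      (fun s => Ent (R s) - Ent (R t) - reTrn ((A t + 1) * (R s - R t))) 0 t := by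
    rw [hasDerivAt_iff_isLittleO] at hE ⊢
    refine Asymptotics.IsBigO.trans_isLittleO (Asymptotics.IsBigO.of_bound 1 ?_) hE
    filter_upwards [eventually_posDef hR.continuousAt hpos hherm] with s hs
    have k1 := reTrn_klein hs hpos
    have k2 := reTrn_klein hpos hs
    have c1 : reTrn (A t * R s) = reTrn (R s * A t) := reTrn_mul_comm _ _
    have c2 : reTrn (A t * R t) = reTrn (R t * A t) := reTrn_mul_comm _ _
    have c3 : reTrn (A s * R s) = reTrn (R s * A s) := reTrn_mul_comm _ _
    have c4 : reTrn (A s * R t) = reTrn (R t * A s) := reTrn_mul_comm _ _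
    simp only [hEnt, sub_self, mul_zero, map_zero, smul_zero, sub_zero, one_mul, add_mul, mul_sub,
      sub_mul, map_add, map_sub, c1, c2, c3, c4, Real.norm_eq_abs]
    rw [abs_of_nonneg, abs_of_nonneg] <;> simp only [hA] <;> linarith
  have := (hD.add hL).add_const (Ent (R t))
  rw [zero_add] at this
  refine this.congr_of_eventuallyEq (Eventually.of_forall fun s => ?_)
  simp

end EntropyDerivative

section Semigroup

open scoped Matrix.Norms.L2Operator Topology

variable {ι : Type*} [Fintype ι] [DecidableEq ι] (Q : QMS ι)

lemma hasDerivAt_matrix {X : ℝ → Mat ι} {X' : Mat ι} {t : ℝ}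
    (h : ∀ i j, HasDerivAt (fun s => X s i j) (X' i j) t) : HasDerivAt X X' t := by
  have e : ∀ Y : Mat ι, Y = ∑ i, ∑ j, Y i j • Matrix.single i j (1 : ℂ) := by
    intro Y
    conv_lhs => rw [matrix_eq_sum_single Y]
    simp [smul_single]
  rw [show X = fun s => ∑ i, ∑ j, X s i j • Matrix.single i j (1 : ℂ) from funext fun s => e _,
    e X']
  exact HasDerivAt.fun_sum fun i _ => HasDerivAt.fun_sum fun j _ => (h i j).smul_const _

lemma P_sub_apply (s t : ℝ) (x : Mat ι) : Q.P s x = Q.P (s - t) (Q.P t x) := by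
  rw [← LinearMap.comp_apply, ← Q.P_add, sub_add_cancel]

lemma hasDerivAt_P (x : Mat ι) (t : ℝ) :
    HasDerivAt (fun s => Q.P s x) (-Q.gen (Q.P t x)) t := by
  refine hasDerivAt_matrix fun i j => ?_
  have h := (sub_self t).symm ▸ Q.P_deriv (Q.P t x) i j
  have h2 := HasDerivAt.comp_sub_const t t h
  refine h2.congr_of_eventuallyEq (Eventually.of_forall fun s => ?_)
  simp only [← P_sub_apply]

lemma gen_P (t : ℝ) (x : Mat ι) : Q.gen (Q.P t x) = Q.P t (Q.gen x) := by
  have h1 := hasDerivAt_P Q (Q.P t x) 0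
  have h2 := hasDerivAt_P Q x 0
  have h3 := ((Q.P t).restrictScalars ℝ).toContinuousLinearMap.hasFDerivAt.comp_hasDerivAt 0 h2
  have h4 : (fun s => Q.P s (Q.P t x)) = fun s => Q.P t (Q.P s x) := by
    funext s
    rw [← LinearMap.comp_apply, ← LinearMap.comp_apply, ← Q.P_add, ← Q.P_add, add_comm]
  rw [h4] at h1
  have := h1.unique h3
  simpa [Q.P_zero] using this

variable {Q}

lemma P_posSemidef {t : ℝ} (ht : 0 ≤ t) {A : Mat ι} (hA : A.PosSemidef) :
    (Q.P t A).PosSemidef := by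
  have h := Q.P_cp t ht 1 (fun _ _ => A) (hA.submatrix Prod.snd)
  exact h.submatrix fun i => (0, i)

lemma P_isHermitian_of_nonneg {t : ℝ} (ht : 0 ≤ t) {A : Mat ι} (hA : A.IsHermitian) :
    (Q.P t A).IsHermitian := by
  have e : (4 : ℂ) • A = (1 + A)ᴴ * (1 + A) - (1 - A)ᴴ * (1 - A) := by
    simp only [conjTranspose_add, conjTranspose_sub, conjTranspose_one, hA.eq]
    rw [show (4 : ℂ) = 1 + 1 + 1 + 1 by norm_num]
    simp only [add_smul, one_smul]
    noncomm_ring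
  have h1 := (P_posSemidef (Q := Q) ht (posSemidef_conjTranspose_mul_self (1 + A))).isHermitian
  have h2 := (P_posSemidef (Q := Q) ht (posSemidef_conjTranspose_mul_self (1 - A))).isHermitian
  have h3 := h1.sub h2
  rw [← map_sub, ← e, map_smul, IsHermitian, conjTranspose_smul] at h3
  have h4 : star (4 : ℂ) = 4 := by simp
  rw [h4] at h3
  exact smul_right_injective _ (four_ne_zero (α := ℂ)) h3

lemma P_conjTranspose {t : ℝ} (ht : 0 ≤ t) (b : Mat ι) : (Q.P t b)ᴴ = Q.P t bᴴ := by
  have h1 : (b + bᴴ).IsHermitian := isHermitian_add_transpose_self b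
  have h2 : (Complex.I • (b - bᴴ)).IsHermitian := by
    simp [IsHermitian, conjTranspose_smul, ← smul_neg]
  have k1 := (P_isHermitian_of_nonneg (Q := Q) ht h1).eq
  have k2 := (P_isHermitian_of_nonneg (Q := Q) ht h2).eq
  simp only [map_add, map_sub, map_smul, conjTranspose_smul, conjTranspose_add,
    conjTranspose_sub] at k1 k2
  have k3 : (Q.P t bᴴ)ᴴ - (Q.P t b)ᴴ = Q.P t b - Q.P t bᴴ := by
    refine smul_right_injective _ Complex.I_ne_zero ?_
    simp only [← k2]
    simp [← smul_neg]
  have k4 : (2 : ℂ) • (Q.P t b)ᴴ = (2 : ℂ) • Q.P t bᴴ := by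
    rw [two_smul, two_smul]
    calc (Q.P t b)ᴴ + (Q.P t b)ᴴ
        = ((Q.P t b)ᴴ + (Q.P t bᴴ)ᴴ) - ((Q.P t bᴴ)ᴴ - (Q.P t b)ᴴ) := by abel
      _ = Q.P t bᴴ + Q.P t bᴴ := by rw [k1, k3]; abel
  exact smul_right_injective _ (two_ne_zero (α := ℂ)) k4

lemma P_isHermitian (t : ℝ) {A : Mat ι} (hA : A.IsHermitian) : (Q.P t A).IsHermitian := by
  rcases le_total 0 t with ht | ht
  · exact P_isHermitian_of_nonneg ht hA
  · have e : ∀ x, Q.P t (Q.P (-t) x) = x := fun x => by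
      rw [← LinearMap.comp_apply, ← Q.P_add, add_neg_cancel, Q.P_zero]; rfl
    have e' : ∀ x, Q.P (-t) (Q.P t x) = x := fun x => by
      rw [← LinearMap.comp_apply, ← Q.P_add, neg_add_cancel, Q.P_zero]; rfl
    have h := P_conjTranspose (Q := Q) (neg_nonneg.2 ht) (Q.P t A)
    rw [e', hA.eq] at h
    rw [IsHermitian, ← e (Q.P t A)ᴴ, ← h]

lemma exists_pos_smul_one_le {A : Mat ι} (hA : A.PosDef) :
    ∃ c : ℝ, 0 < c ∧ (A - c • (1 : Mat ι)).PosSemidef := by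
  cases isEmpty_or_nonempty ι
  · refine ⟨1, one_pos, ?_⟩
    rw [Subsingleton.elim (A - (1 : ℝ) • (1 : Mat ι)) 0]
    exact PosSemidef.zero
  · obtain ⟨i, hi⟩ := Finite.exists_min hA.isHermitian.eigenvalues
    refine ⟨hA.isHermitian.eigenvalues i, hA.eigenvalues_pos i, ?_⟩
    set c := hA.isHermitian.eigenvalues i
    have h : A - c • (1 : Mat ι) = cfc (fun x : ℝ => x - c) A := by
      rw [cfc_sub _ _ A (continuousOn_spectrum A _) (continuousOn_spectrum A _),
        cfc_id' ℝ A hA.isHermitian.isSelfAdjoint, cfc_const _ A hA.isHermitian.isSelfAdjoint,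
        Algebra.algebraMap_eq_smul_one]
    rw [h, cfc_eq_conj_diagonal hA.isHermitian]
    refine PosSemidef.mul_mul_conjTranspose_same (PosSemidef.diagonal fun j => ?_) _
    exact Complex.zero_le_real.2 (sub_nonneg.2 (hi j))

lemma P_posDef {t : ℝ} (ht : 0 ≤ t) {A : Mat ι} (hA : A.PosDef) : (Q.P t A).PosDef := by
  obtain ⟨c, hc, h⟩ := exists_pos_smul_one_le hA
  have h1 := P_posSemidef (Q := Q) ht h
  have e : Q.P t A = (c : ℂ) • (1 : Mat ι) + Q.P t (A - c • (1 : Mat ι)) := by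
    rw [map_sub, ← Complex.coe_smul, map_smul, Q.P_unital t ht, add_sub_cancel]
  rw [e]
  exact (PosDef.one.smul (by exact_mod_cast hc)).add_posSemidef h1

end Semigroup

end CD

namespace CD

section FisherInformation

variable {ι : Type*} [Fintype ι] [DecidableEq ι]

omit [DecidableEq ι] in
lemma inn_re_comm (x y : Mat ι) : (inn x y).re = (inn y x).re := by
  have h : inn y x = star (inn x y) := by
    simp only [inn, trn, star_mul', ← trace_conjTranspose, conjTranspose_mul,
      conjTranspose_conjTranspose]
    simp
  rw [h]; simp

omit [DecidableEq ι] in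
lemma inn_comm_conjTranspose (v x y : Mat ι) : inn x (comm vᴴ y) = inn (comm v x) y := by
  simp only [inn, trn, comm, conjTranspose_sub, conjTranspose_mul, mul_sub, sub_mul, trace_sub]
  rw [← mul_assoc, ← mul_assoc, trace_mul_comm (xᴴ * y) vᴴ, mul_assoc vᴴ xᴴ y]

variable {d : ℕ} {L : Mat ι →ₗ[ℂ] Mat ι} {v : Fin d → Mat ι}

lemma re_inn_lindblad (hL : LindbladForm L v) {A : Mat ι} (hA : A.PosDef) (b : Mat ι) :
    (inn b (L A)).re = ∑ j, (inn (logMean A (comm (v j) (mlog A))) (comm (v j) b)).re := by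
  have h : inn b (L A) = ∑ j, inn (comm (v j) b) (comm (v j) A) := by
    simp only [← inn_comm_conjTranspose]
    rw [hL.2 A]
    simp [inn, trn, trace_sum, Finset.mul_sum]
  rw [h, Complex.re_sum]
  refine Finset.sum_congr rfl fun j _ => ?_
  rw [logMean_comm_mlog hA, inn_re_comm]

lemma re_inn_mlog_eq_dNormSqLog (hL : LindbladForm L v) {A : Mat ι} (hA : A.PosDef) :
    (inn (mlog A) (L A)).re = dNormSqLog v A (mlog A) :=
  re_inn_lindblad hL hA _

lemma re_inn_mlog_nonneg (hL : LindbladForm L v) {A : Mat ι} (hA : A.PosDef) :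
    0 ≤ (inn (mlog A) (L A)).re := by
  rw [re_inn_lindblad hL hA]
  exact Finset.sum_nonneg fun j _ => re_inn_logMean_self_nonneg hA _

lemma sq_re_inn_lindblad_le (hL : LindbladForm L v) {A : Mat ι} (hA : A.PosDef) (b : Mat ι) :
    (inn b (L A)).re ^ 2 ≤ dNormSqLog v A b * (inn (mlog A) (L A)).re := by
  rw [re_inn_lindblad hL hA b, re_inn_lindblad hL hA (mlog A)]
  exact sq_sum_re_inn_logMean_le hA _ _

omit [DecidableEq ι] in
lemma trn_lindblad (hL : LindbladForm L v) (x : Mat ι) : trn (L x) = 0 := by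
  have h (y z : Mat ι) : (comm y z).trace = 0 := by
    rw [comm, trace_sub, trace_mul_comm, sub_self]
  simp [hL.2 x, trn, trace_sum, h]

lemma cK_nonneg (K : ℝ) {t : ℝ} (ht : 0 ≤ t) : 0 ≤ cK K t := by
  unfold cK
  split_ifs with h
  · positivity
  · rcases lt_or_gt_of_ne h with h | h
    · refine div_nonneg_of_nonpos (sub_nonpos.2 (Real.one_le_exp ?_)) h.le
      nlinarith
    · refine div_nonneg (sub_nonneg.2 (Real.exp_le_one_iff.2 ?_)) h.le
      have := mul_nonneg h.le ht
      linarith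

lemma hasDerivAt_exp_neg_mul (K : ℝ) :
    HasDerivAt (fun t : ℝ => Real.exp (-(2 * K * t))) (-(2 * K)) 0 := by
  have := (((hasDerivAt_id (0 : ℝ)).const_mul (2 * K)).neg).exp
  simpa using this

lemma hasDerivAt_cK (K : ℝ) : HasDerivAt (cK K) 2 0 := by
  unfold cK
  split_ifs with h
  · simpa using (hasDerivAt_id (0 : ℝ)).const_mul 2
  · have h1 := ((hasDerivAt_exp_neg_mul K).const_sub 1).div_const K
    rwa [neg_neg, mul_div_cancel_right₀ _ h] at h1

lemma cK_zero (K : ℝ) : cK K 0 = 0 := by simp [cK]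

lemma deriv_nonneg_of_nonneg_right {g : ℝ → ℝ} {g' : ℝ} (hg : HasDerivAt g g' 0) (h0 : g 0 = 0)
    (hpos : ∀ s, 0 ≤ s → 0 ≤ g s) : 0 ≤ g' := by
  have h := hg.hasDerivWithinAt (s := Set.Ioi 0)
  rw [hasDerivWithinAt_iff_tendsto_slope' (by simp)] at h
  refine ge_of_tendsto h ?_
  filter_upwards [self_mem_nhdsWithin] with s hs
  have hs' : (0 : ℝ) < s := hs
  rw [slope_def_field, h0, sub_zero, sub_zero]
  exact div_nonneg (hpos s hs'.le) hs'.le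

end FisherInformation

section EntropyPower

open scoped Matrix.Norms.L2Operator Topology

variable {ι : Type*} [Fintype ι] [DecidableEq ι] {Q : QMS ι} {d : ℕ} {v : Fin d → Mat ι}

/-- The Fisher information `⟨log ρ, L ρ⟩`, that is, minus the derivative of the entropy along the
semigroup. -/
noncomputable def fisherInfo (L : Mat ι →ₗ[ℂ] Mat ι) (A : Mat ι) : ℝ := (inn (mlog A) (L A)).re

lemma fisherInfo_eq_reTrn (L : Mat ι →ₗ[ℂ] Mat ι) (A : Mat ι) :
    fisherInfo L A = reTrn (mlog A * L A) := by
  rw [fisherInfo, inn, (isHermitian_mlog A).eq, reTrn_apply]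

lemma differentiableAt_fisherInfo {ρ : Mat ι} (hρ : ρ.IsHermitian) {t : ℝ}
    (ht : (Q.P t ρ).PosDef) : DifferentiableAt ℝ (fun s => fisherInfo Q.gen (Q.P s ρ)) t := by
  simp only [fisherInfo_eq_reTrn]
  have h1 := differentiableAt_mlog_comp (hasDerivAt_P Q ρ t).differentiableAt ht
    fun s => P_isHermitian s hρ
  have h2 : DifferentiableAt ℝ (fun s => Q.gen (Q.P s ρ)) t := by
    simp only [gen_P]
    exact (hasDerivAt_P Q (Q.gen ρ) t).differentiableAt
  exact reTrn.differentiableAt.comp t (h1.mul h2)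

lemma hasDerivAt_Ent_P (hL : LindbladForm Q.gen v) {ρ : Mat ι} (hρ : ρ.IsHermitian) {t : ℝ}
    (ht : (Q.P t ρ).PosDef) :
    HasDerivAt (fun s => Ent (Q.P s ρ)) (-fisherInfo Q.gen (Q.P t ρ)) t := by
  have h := hasDerivAt_Ent (hasDerivAt_P Q ρ t) ht fun s => P_isHermitian s hρ
  have h0 : reTrn (Q.gen (Q.P t ρ)) = 0 := by rw [reTrn_apply, trn_lindblad hL]; rfl
  rwa [mul_neg, map_neg, add_mul, one_mul, map_add, h0, add_zero, ← fisherInfo_eq_reTrn] at h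

lemma eventually_posDef_P {ρ : Mat ι} (hρ : ρ.IsHermitian) {t : ℝ} (ht : (Q.P t ρ).PosDef) :
    ∀ᶠ s in 𝓝 t, (Q.P s ρ).PosDef :=
  eventually_posDef (hasDerivAt_P Q ρ t).continuousAt ht fun s => P_isHermitian s hρ

lemma trn_P (hsymm : TraciallySymm Q) {t : ℝ} (ht : 0 ≤ t) (x : Mat ι) :
    trn (Q.P t x) = trn x := by
  have := hsymm t ht x 1
  rwa [mul_one, Q.P_unital t ht, mul_one] at this

/-- The gradient estimate controls the decay of the Fisher information along the semigroup. -/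
lemma fisherInfo_P_le (hsymm : TraciallySymm Q) (hL : LindbladForm Q.gen v) {K N : ℝ} (hN : 0 < N)
    (hGE : GElog Q.P Q.gen v K N⁻¹) {ρ : Mat ι} (hρ : ρ.PosDef) (hρ1 : trn ρ = 1) {s : ℝ}
    (hs : 0 ≤ s) :
    fisherInfo Q.gen (Q.P s ρ) ≤
      (Real.exp (-(2 * K * s)) - N⁻¹ * cK K s * fisherInfo Q.gen (Q.P s ρ)) *
        fisherInfo Q.gen ρ := by
  have hσ : (Q.P s ρ).PosDef := P_posDef hs hρ
  set a := mlog (Q.P s ρ)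
  have hx : fisherInfo Q.gen (Q.P s ρ) = (inn (Q.P s a) (Q.gen ρ)).re := by
    rw [fisherInfo, inn, inn, gen_P, ← hsymm s hs, P_conjTranspose hs]
  have hx0 : 0 ≤ fisherInfo Q.gen (Q.P s ρ) := re_inn_mlog_nonneg hL hσ
  have hI0 : 0 ≤ fisherInfo Q.gen ρ := re_inn_mlog_nonneg hL hρ
  have hcs := sq_re_inn_lindblad_le hL hρ (Q.P s a)
  rw [← hx] at hcs
  have hge := hGE s hs a ρ hρ hρ1
  rw [← re_inn_mlog_eq_dNormSqLog hL hσ] at hge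
  have hsq : fisherInfo Q.gen (Q.P s ρ) ^ 2 ≤ Complex.normSq (inn a (Q.gen (Q.P s ρ))) := by
    rw [Complex.normSq_apply, fisherInfo]
    nlinarith [mul_self_nonneg (inn a (Q.gen (Q.P s ρ))).im]
  have hc : 0 ≤ N⁻¹ * cK K s := mul_nonneg (by positivity) (cK_nonneg K hs)
  have h1 := mul_le_mul_of_nonneg_left hsq hc
  change _ ≤ _ * fisherInfo Q.gen (Q.P s ρ) - _ at hge
  change _ ≤ _ * fisherInfo Q.gen ρ at hcs
  set x := fisherInfo Q.gen (Q.P s ρ)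
  set I₀ := fisherInfo Q.gen ρ
  rcases hx0.eq_or_lt with h | h
  · rw [← h, mul_zero, sub_zero]
    positivity
  · have h2 : dNormSqLog v ρ (Q.P s a) ≤ x * (Real.exp (-(2 * K * s)) - N⁻¹ * cK K s * x) := by
      linarith
    have h3 := hcs.trans (mul_le_mul_of_nonneg_right h2 hI0)
    refine le_of_mul_le_mul_left ?_ h
    linarith

lemma deriv_fisherInfo_le (hsymm : TraciallySymm Q) (hL : LindbladForm Q.gen v) {K N : ℝ}
    (hN : 0 < N) (hGE : GElog Q.P Q.gen v K N⁻¹) {ρ : Mat ι} (hρ : ρ.PosDef) (hρ1 : trn ρ = 1)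
    {t : ℝ} (ht : 0 ≤ t) {I' : ℝ}
    (hI : HasDerivAt (fun s => fisherInfo Q.gen (Q.P s ρ)) I' t) :
    I' ≤ -(2 * K) * fisherInfo Q.gen (Q.P t ρ) - 2 / N * fisherInfo Q.gen (Q.P t ρ) ^ 2 := by
  set I := fun s => fisherInfo Q.gen (Q.P s ρ) with hIdef
  have hσ : (Q.P t ρ).PosDef := P_posDef ht hρ
  have hshift : HasDerivAt (fun s => I (s + t)) I' 0 :=
    HasDerivAt.comp_add_const 0 t (by rwa [zero_add])
  have hg := ((((hasDerivAt_exp_neg_mul K).sub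
    (((hasDerivAt_cK K).const_mul N⁻¹).mul hshift)).mul_const (I t)).sub hshift)
  have h := deriv_nonneg_of_nonneg_right hg (by simp [cK_zero]) fun s hs => by
    have := fisherInfo_P_le hsymm hL hN hGE hσ (by rw [trn_P hsymm ht, hρ1]) hs
    rw [← LinearMap.comp_apply, ← Q.P_add] at this
    exact sub_nonneg.2 this
  simp only [cK_zero, zero_add, mul_zero, zero_mul, add_zero] at h
  change I' ≤ -(2 * K) * I t - 2 / N * I t ^ 2
  have e : 2 / N * I t ^ 2 = N⁻¹ * 2 * I t * I t := by ring
  linarith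

end EntropyPower


/-- (Concavity of entropy power.) If a tracially symmetric quantum
Markov semigroup with Lindblad form satisfies `GE(K,N)` for the logarithmic mean
(`K ∈ ℝ`, `N ∈ (0,∞)`), then for every invertible density matrix `ρ` the entropy power
`F(t) = exp(−2·Ent(P_tρ)/N)` satisfies `F'' ≤ −2K·F'` on `[0,∞)`; in particular, if
`K ≥ 0` the entropy power is concave on `[0,∞)`. -/
theorem entropyPower_concave {n d : ℕ} (Q : QMS (Fin n)) (hsymm : TraciallySymm Q)
    (v : Fin d → Mat (Fin n)) (hLind : LindbladForm Q.gen v)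
    (K N : ℝ) (hN : 0 < N) (hGE : GElog Q.P Q.gen v K N⁻¹)
    (ρ : Mat (Fin n)) (hρ : ρ.PosDef) (hρ1 : trn ρ = 1)
    (F : ℝ → ℝ) (hF : F = fun t => Real.exp (-(2 * Ent (Q.P t ρ) / N))) :
    (∀ t : ℝ, 0 ≤ t →
      DifferentiableAt ℝ F t ∧ DifferentiableAt ℝ (deriv F) t ∧
        deriv (deriv F) t ≤ -(2 * K) * deriv F t) ∧
    (0 ≤ K → ConcaveOn ℝ (Set.Ici 0) F) := by
  have hherm := hρ.isHermitian
  set I : ℝ → ℝ := fun s => fisherInfo Q.gen (Q.P s ρ) with hI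
  have hF1 : ∀ s, (Q.P s ρ).PosDef → HasDerivAt F (2 / N * I s * F s) s := by
    intro s hs
    have h := (((hasDerivAt_Ent_P hLind hherm hs).const_mul 2).div_const N).neg.exp
    have e : 2 / N * I s * F s = Real.exp (-(2 * Ent (Q.P s ρ) / N)) *
        -(2 * -fisherInfo Q.gen (Q.P s ρ) / N) := by
      simp only [hF, hI]
      ring
    rw [e, hF]
    exact h
  have hmain : ∀ t : ℝ, 0 ≤ t → DifferentiableAt ℝ F t ∧ DifferentiableAt ℝ (deriv F) t ∧
      deriv (deriv F) t ≤ -(2 * K) * deriv F t := by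
    intro t ht
    have hpos : (Q.P t ρ).PosDef := P_posDef ht hρ
    have hev : deriv F =ᶠ[nhds t] fun s => 2 / N * I s * F s := by
      filter_upwards [eventually_posDef_P hherm hpos] with s hs using (hF1 s hs).deriv
    have hId := (differentiableAt_fisherInfo hherm hpos).hasDerivAt
    have hF2 := ((hId.const_mul (2 / N)).mul (hF1 t hpos)).congr_of_eventuallyEq hev
    have hle := deriv_fisherInfo_le hsymm hLind hN hGE hρ hρ1 ht hId
    refine ⟨(hF1 t hpos).differentiableAt, hF2.differentiableAt, ?_⟩
    rw [hF2.deriv, (hF1 t hpos).deriv]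
    have hFpos : 0 < F t := by rw [hF]; exact Real.exp_pos _
    have := mul_le_mul_of_nonneg_left hle (by positivity : 0 ≤ 2 / N * F t)
    simp only [hI] at this ⊢
    linarith
  refine ⟨hmain, fun hK => ?_⟩
  refine concaveOn_of_deriv2_nonpos (convex_Ici 0)
    (fun t ht => (hmain t ht).1.continuousAt.continuousWithinAt)
    (fun t ht => (hmain t (interior_subset ht)).1.differentiableWithinAt)
    (fun t ht => (hmain t (interior_subset ht)).2.1.differentiableWithinAt) fun t ht => ?_
  have ht0 : (0 : ℝ) ≤ t := interior_subset ht
  have hpos : (Q.P t ρ).PosDef := P_posDef ht0 hρ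
  refine (hmain t ht0).2.2.trans ?_
  rw [(hF1 t hpos).deriv]
  have hIpos : 0 ≤ I t := re_inn_mlog_nonneg hLind hpos
  have hFpos : 0 < F t := by rw [hF]; exact Real.exp_pos _
  have : 0 ≤ 2 * K * (2 / N * I t * F t) := by positivity
  linarith

end CD
end

section
/- Let τ be the normalized trace on M_d(ℂ) and let (P_t) be the depolarizing semigroup P_t(a) = e^{−t}·a + (1 − e^{−t})·τ(a)·1, whose generator is L(a) = a − τ(a)·1. Then (P_t) satisfies BE(1/2, 2d): Γ₂(a) ≥ ½·Γ(a) + (1/(2d))·|L a|² for all a ∈ M_d(ℂ). -/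
open Matrix Filter
open scoped ComplexOrder ENNReal Kronecker

namespace CD

/-- A positive semidefinite matrix is bounded above by its trace. -/
theorem posSemidef_trace_smul_one_sub {n : Type*} [Fintype n] [DecidableEq n]
    {A : Matrix n n ℂ} (hA : A.PosSemidef) :
    (A.trace • (1 : Matrix n n ℂ) - A).PosSemidef := by
  have hdiag : A.trace • (1 : Matrix n n ℂ) - A =
      (hA.1.eigenvectorUnitary : Matrix n n ℂ) *
        diagonal (fun i => A.trace - (hA.1.eigenvalues i : ℂ)) *
        (hA.1.eigenvectorUnitary : Matrix n n ℂ)ᴴ := by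
    have hd : diagonal (fun i => A.trace - (hA.1.eigenvalues i : ℂ)) =
        A.trace • (1 : Matrix n n ℂ) - diagonal (RCLike.ofReal ∘ hA.1.eigenvalues) := by
      rw [smul_one_eq_diagonal, diagonal_sub]
      rfl
    have hU : (hA.1.eigenvectorUnitary : Matrix n n ℂ) *
        (hA.1.eigenvectorUnitary : Matrix n n ℂ)ᴴ = 1 :=
      Unitary.coe_mul_star_self hA.1.eigenvectorUnitary
    have hS := hA.1.spectral_theorem
    rw [Unitary.conjStarAlgAut_apply, star_eq_conjTranspose] at hS
    rw [hd, mul_sub, sub_mul, ← hS, mul_smul_comm, mul_one, smul_mul_assoc, hU]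
  rw [hdiag]
  refine PosSemidef.mul_mul_conjTranspose_same (PosSemidef.diagonal fun i => ?_) _
  rw [hA.1.trace_eq_sum_eigenvalues, Pi.zero_apply, sub_nonneg]
  exact Finset.single_le_sum (f := fun j => (hA.1.eigenvalues j : ℂ))
    (fun j _ => by exact_mod_cast hA.eigenvalues_nonneg j) (Finset.mem_univ i)

section

variable {ι : Type*} [Fintype ι]

theorem trn_add (x y : Mat ι) : trn (x + y) = trn x + trn y := by
  simp [trn, mul_add]

theorem trn_sub (x y : Mat ι) : trn (x - y) = trn x - trn y := by
  simp [trn, mul_sub]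

theorem trn_smul (c : ℂ) (x : Mat ι) : trn (c • x) = c * trn x := by
  simp only [trn, trace_smul, smul_eq_mul]
  ring

theorem trn_one [DecidableEq ι] [Nonempty ι] : trn (1 : Mat ι) = 1 := by
  simp [trn]

variable [DecidableEq ι] {L : Mat ι →ₗ[ℂ] Mat ι}

/-- For the depolarizing generator, `Γ` only sees the centered parts of its arguments. -/
theorem Gamma_add_smul_one (hL : ∀ a, L a = a - trn a • (1 : Mat ι)) [Nonempty ι]
    {x y : Mat ι} (hx : trn x = 0) (hy : trn y = 0) (c e : ℂ) :
    Gamma L (x + c • 1) (y + e • 1) = (2 : ℂ)⁻¹ • (xᴴ * y + trn (xᴴ * y) • 1) := by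
  have hx' : trn xᴴ = 0 := by
    simp only [trn, trace_conjTranspose, mul_eq_zero] at hx ⊢
    exact hx.imp_right fun h => by rw [h, star_zero]
  simp only [Gamma, hL, conjTranspose_add, conjTranspose_sub, conjTranspose_smul,
    conjTranspose_one, add_mul, mul_add, smul_mul_assoc, mul_smul_comm, mul_one, one_mul,
    trn_add, trn_smul, trn_one, hx, hy, hx', mul_zero, zero_add, mul_sub, sub_mul]
  module

/-- The second-order form of the depolarizing generator on centered parts. -/
theorem Gamma2_add_smul_one (hL : ∀ a, L a = a - trn a • (1 : Mat ι)) [Nonempty ι]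
    {x : Mat ι} (hx : trn x = 0) (c : ℂ) :
    Gamma2 L (x + c • 1) (x + c • 1) =
      (4 : ℂ)⁻¹ • (xᴴ * x + (3 * trn (xᴴ * x)) • 1) := by
  have hLx : L (x + c • 1) = x + (0 : ℂ) • 1 := by
    simp only [hL, trn_add, trn_smul, trn_one, hx]
    module
  simp only [Gamma2, hLx, Gamma_add_smul_one hL hx hx]
  simp only [hL, trn_add, trn_smul, trn_one]
  module

end

/-- (Depolarizing semigroup.) The generator `L(a) = a − τ(a)·1` of the
depolarizing semigroup `P_t(a) = e^{−t}a + (1−e^{−t})τ(a)1` on `M_d(ℂ)` satisfies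
`BE(1/2, 2d)`: `Γ₂(a) ≥ ½Γ(a) + (1/(2d))|La|²` for all `a ∈ M_d(ℂ)`. -/
theorem depolarizing_BE {d : ℕ} (hd : 0 < d)
    (P : ℝ → Mat (Fin d) →ₗ[ℂ] Mat (Fin d)) (L : Mat (Fin d) →ₗ[ℂ] Mat (Fin d))
    (hP : ∀ (t : ℝ) (a : Mat (Fin d)),
      P t a = Real.exp (-t) • a +
        (((1 : ℂ) - Real.exp (-t)) * trn a) • (1 : Mat (Fin d)))
    (hL : ∀ a : Mat (Fin d), L a = a - trn a • (1 : Mat (Fin d))) :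
    BE L (1/2 : ℝ) (2 * d : ℝ)⁻¹ := by
  intro a
  have : Nonempty (Fin d) := ⟨⟨0, hd⟩⟩
  have hb : trn (L a) = 0 := by
    rw [hL, trn_sub, trn_smul, trn_one, mul_one, sub_self]
  have ha : a = L a + trn a • 1 := by
    rw [hL, sub_add_cancel]
  have hG := Gamma_add_smul_one hL hb hb (trn a) (trn a)
  have hG2 := Gamma2_add_smul_one hL hb (trn a)
  rw [← ha] at hG hG2
  set b := L a
  have hT : trn (bᴴ * b) = (d : ℂ)⁻¹ * (bᴴ * b).trace := by
    rw [trn, Fintype.card_fin]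
  have key : Gamma2 L a a -
      ((1 / 2 : ℝ) • Gamma L a a + ((2 * d : ℝ)⁻¹) • (bᴴ * b)) =
      ((2 * d : ℝ)⁻¹) • ((bᴴ * b).trace • (1 : Mat (Fin d)) - bᴴ * b) := by
    rw [hG, hG2, hT]
    simp only [RCLike.real_smul_eq_coe_smul (K := ℂ)]
    push_cast
    module
  rw [matLE, key]
  exact (posSemidef_trace_smul_one_sub (posSemidef_conjTranspose_mul_self b)).smul
    (by positivity)

end CD
end
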